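/- Let G=(V,E) be a finite undirected graph, let κ = (ν,P,P̂,U) ∈ K_n with U real and with p, p̂ probability vectors with all entries positive, and let K(ξ,η) be the multivariate Krawtchouk polynomials associated with κ and 2j. Define D(ξ,η) = Π_{x∈V} K(ξ^x, η^x) for configurations ξ, η ∈ Ω_{2j}^V. Then the multi-species SEP(2j) on G is self-dual with duality function D at the level of generators: for all ξ, η ∈ Ω_{2j}^V, [L D(·,η)](ξ) = [L D(ξ,·)](η), where L is the generator of the multi-species SEP(2j). -/

import Mathlib

/-- The state space `Ω_{2j}`; `m` plays the role of `2j`. -/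
def Omega (n m : ℕ) : Finset (Fin (n + 1) → ℕ) :=
  Finset.Nat.antidiagonalTuple (n + 1) m

/-- `conf ξ k l = ξ + e_k − e_l` (truncated subtraction on ℕ). -/
def conf {d : ℕ} (ξ : Fin d → ℕ) (k l : Fin d) : Fin d → ℕ :=
  fun i => (if i = k then ξ i + 1 else ξ i) - (if i = l then 1 else 0)

/-- The configuration `ξ^{x,y}_{l,k}`: at site `x` replace `ξ^x` by `ξ^x − e_l + e_k`,
at site `y` replace `ξ^y` by `ξ^y − e_k + e_l`. -/
def sepMove {V : Type*} [DecidableEq V] {d : ℕ} (ζ : V → Fin d → ℕ) (x y : V)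
    (k l : Fin d) : V → Fin d → ℕ :=
  fun v => if v = x then conf (ζ x) k l else if v = y then conf (ζ y) l k else ζ v

/-- Single-edge generator `L_{x,y}` of the multi-species SEP(2j). -/
noncomputable def sepEdge {V : Type*} [DecidableEq V] (n : ℕ) (x y : V)
    (f : (V → Fin (n + 1) → ℕ) → ℝ) (ζ : V → Fin (n + 1) → ℕ) : ℝ :=
  ∑ k : Fin (n + 1), ∑ l : Fin (n + 1),
    if k < l then
      (ζ x l * ζ y k : ℝ) * (f (sepMove ζ x y k l) - f ζ) +
        (ζ y l * ζ x k : ℝ) * (f (sepMove ζ y x k l) - f ζ)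
    else 0

/-- Generator of the multi-species SEP(2j) on a finite undirected graph whose edges are
listed (in an arbitrary orientation, which is irrelevant since `L_{x,y} = L_{y,x}`). -/
noncomputable def sepGen {V : Type*} [DecidableEq V] (n : ℕ) (E : Finset (V × V))
    (f : (V → Fin (n + 1) → ℕ) → ℝ) (ζ : V → Fin (n + 1) → ℕ) : ℝ :=
  ∑ e ∈ E, sepEdge n e.1 e.2 f ζ

open MvPolynomial in
/-- the linear form `∑ l, U k l * X l` -/
noncomputable def linF {d : ℕ} (U : Matrix (Fin d) (Fin d) ℝ) (k : Fin d) :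
    MvPolynomial (Fin d) ℝ := ∑ l, C (U k l) * X l

/-- the homogeneous generating polynomial -/
noncomputable def genF {d : ℕ} (U : Matrix (Fin d) (Fin d) ℝ) (η : Fin d → ℕ) :
    MvPolynomial (Fin d) ℝ := ∏ k, linF U k ^ η k

/-- remove one particle of type `l` -/
def dec {d : ℕ} (ξ : Fin d → ℕ) (l : Fin d) : Fin d → ℕ :=
  fun i => ξ i - if i = l then 1 else 0

lemma conf_eq {d : ℕ} (ξ : Fin d → ℕ) (k l : Fin d) (h : ξ l ≠ 0) :
    conf ξ k l = fun i => dec ξ l i + if i = k then 1 else 0 := by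
  funext i
  unfold conf dec
  by_cases h2 : i = l
  · subst h2
    split_ifs <;> omega
  · rw [if_neg h2]
    split_ifs <;> omega

lemma dec_eq {d : ℕ} (ξ : Fin d → ℕ) (l : Fin d) (h : ξ l ≠ 0) :
    ξ = fun i => dec ξ l i + if i = l then 1 else 0 := by
  funext i
  unfold dec
  by_cases h2 : i = l
  · subst h2; simp; omega
  · simp [h2]

lemma mem_Omega {n m : ℕ} {ξ : Fin (n+1) → ℕ} : ξ ∈ Omega n m ↔ ∑ i, ξ i = m :=
  Finset.Nat.mem_antidiagonalTuple

lemma conf_mem {n m : ℕ} {ξ : Fin (n+1) → ℕ} (hξ : ξ ∈ Omega n m) (k l) (h : ξ l ≠ 0) :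
    conf ξ k l ∈ Omega n m := by
  rw [mem_Omega] at *
  rw [conf_eq ξ k l h]
  rw [dec_eq ξ l h] at hξ
  simpa [Finset.sum_add_distrib] using hξ

lemma conf_self {d : ℕ} (ξ : Fin d → ℕ) (k : Fin d) : conf ξ k k = ξ := by
  funext i
  unfold conf
  by_cases h : i = k <;> simp [h]

lemma genF_add {d : ℕ} (U : Matrix (Fin d) (Fin d) ℝ) (μ : Fin d → ℕ) (b : Fin d) :
    genF U (fun i => μ i + if i = b then 1 else 0) = linF U b * genF U μ := by
  unfold genF
  simp only [pow_add, Finset.prod_mul_distrib]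
  rw [mul_comm]
  congr 1
  simp [pow_ite]

lemma prod_fact_add {d : ℕ} (μ : Fin d → ℕ) (b : Fin d) :
    (∏ i, (Nat.factorial (μ i + if i = b then 1 else 0) : ℝ)) =
      (μ b + 1) * ∏ i, (Nat.factorial (μ i) : ℝ) := by
  have : ∀ i, (Nat.factorial (μ i + if i = b then 1 else 0) : ℝ) =
      (if i = b then ((μ i : ℝ) + 1) else 1) * (Nat.factorial (μ i) : ℝ) := by
    intro i
    by_cases h : i = b
    · simp [h, Nat.factorial_succ]
    · simp [h]
  simp only [this, Finset.prod_mul_distrib]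
  simp

lemma deriv_prod {ι : Type*} [DecidableEq ι] {A : Type*} [CommRing A] [Algebra ℝ A]
    (D : Derivation ℝ A A) (f : ι → A)
    (η : ι → ℕ) (s : Finset ι) :
    D (∏ k ∈ s, f k ^ η k) =
      ∑ a ∈ s, (η a : A) * D (f a) * ∏ k ∈ s, f k ^ (η k - if k = a then 1 else 0) := by
  induction s using Finset.induction_on with
  | empty => simp
  | insert x s hx ih =>
    rw [Finset.prod_insert hx, D.leibniz, ih, Finset.sum_insert hx, Finset.prod_insert hx,
      D.leibniz_pow]
    have h1 : ∏ k ∈ s, f k ^ (η k - if k = x then 1 else 0) = ∏ k ∈ s, f k ^ η k := by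
      refine Finset.prod_congr rfl fun k hk => ?_
      rw [if_neg (by rintro rfl; exact hx hk)]; simp
    have h2 : ∀ a ∈ s, (η a : A) * D (f a) *
        ∏ k ∈ insert x s, f k ^ (η k - if k = a then 1 else 0) =
        f x ^ η x * ((η a : A) * D (f a) * ∏ k ∈ s, f k ^ (η k - if k = a then 1 else 0)) := by
      intro a ha
      rw [Finset.prod_insert hx, if_neg (by rintro rfl; exact hx ha)]
      simp only [Nat.sub_zero]; ring
    rw [Finset.sum_congr rfl h2, h1, ← Finset.mul_sum]
    simp only [smul_eq_mul, nsmul_eq_mul, if_true]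
    ring

open MvPolynomial in
lemma pderiv_linF {d : ℕ} (U : Matrix (Fin d) (Fin d) ℝ) (k a : Fin d) :
    pderiv k (linF U a) = C (U a k) := by
  classical
  unfold linF
  simp [pderiv_X, Pi.single_apply]

open MvPolynomial in
lemma X_eq {d : ℕ} (U W : Matrix (Fin d) (Fin d) ℝ) (hWU : W * U = 1) (l : Fin d) :
    (X l : MvPolynomial (Fin d) ℝ) = ∑ b, C (W l b) * linF U b := by
  unfold linF
  simp only [Finset.mul_sum]
  rw [Finset.sum_comm]
  have : ∀ y, ∑ x, (C (W l x) * (C (U x y) * X y) : MvPolynomial (Fin d) ℝ) =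
      C ((W * U) l y) * X y := by
    intro y
    simp [Matrix.mul_apply, Finset.sum_mul, mul_assoc]
  simp only [this, hWU, Matrix.one_apply]
  simp [apply_ite C, ite_mul]

open MvPolynomial in
lemma X_mul_pderiv {d : ℕ} (U W : Matrix (Fin d) (Fin d) ℝ) (hWU : W * U = 1)
    (k l : Fin d) (η : Fin d → ℕ) :
    X l * pderiv k (genF U η) =
      ∑ a, ∑ b, C (U a k * W l b * η a) * genF U (conf η b a) := by
  have h := deriv_prod (pderiv k) (linF U) η Finset.univ
  change pderiv k (genF U η) = _ at h
  rw [h, Finset.mul_sum]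
  refine Finset.sum_congr rfl fun a _ => ?_
  by_cases ha : η a = 0
  · simp [ha]
  rw [X_eq U W hWU l, Finset.sum_mul]
  refine Finset.sum_congr rfl fun b _ => ?_
  rw [conf_eq η b a ha, genF_add, pderiv_linF]
  change C (W l b) * linF U b * (_ * genF U (dec η a)) = _
  simp only [map_mul, map_natCast]
  ring

open MvPolynomial in
lemma coeff_genF {n m : ℕ} (U : Matrix (Fin (n + 1)) (Fin (n + 1)) ℝ)
    (hU0 : ∀ k, U k 0 = 1)
    (K : (Fin (n + 1) → ℕ) → (Fin (n + 1) → ℕ) → ℝ)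
    (η : Fin (n + 1) → ℕ) (hη : η ∈ Omega n m)
    (hK : ∀ z : Fin (n + 1) → ℝ,
      ∑ ξ ∈ Omega n m,
          ((Nat.factorial m : ℝ) / ∏ i, (Nat.factorial (ξ i) : ℝ)) * K ξ η *
            ∏ l ∈ Finset.univ.erase (0 : Fin (n + 1)), z l ^ ξ l =
        ∏ k : Fin (n + 1),
          (1 + ∑ l ∈ Finset.univ.erase (0 : Fin (n + 1)), U k l * z l) ^ η k)
    (ξ : Fin (n + 1) → ℕ) (hξ : ξ ∈ Omega n m) :
    coeff (Finsupp.equivFunOnFinite.symm ξ) (genF U η) =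
      ((Nat.factorial m : ℝ) / ∏ i, (Nat.factorial (ξ i) : ℝ)) * K ξ η := by
  classical
  have key : genF U η = ∑ ζ ∈ Omega n m, monomial (Finsupp.equivFunOnFinite.symm ζ)
      (((Nat.factorial m : ℝ) / ∏ i, (Nat.factorial (ζ i) : ℝ)) * K ζ η) := by
    refine funext_set (fun _ => {x : ℝ | x ≠ 0}) (fun _ => ?_) ?_
    · exact (Set.finite_singleton (0:ℝ)).infinite_compl
    intro z hz
    have hz0 : z 0 ≠ 0 := hz 0 (Set.mem_univ _)
    have h := hK (fun i => z i / z 0)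
    have e1 : eval z (genF U η) = z 0 ^ m * ∏ k : Fin (n + 1),
          (1 + ∑ l ∈ Finset.univ.erase (0 : Fin (n + 1)), U k l * (z l / z 0)) ^ η k := by
      rw [mem_Omega] at hη
      rw [← hη, ← Finset.prod_pow_eq_pow_sum, ← Finset.prod_mul_distrib]
      simp only [genF, linF, map_prod, map_pow, map_sum, map_mul, eval_C, eval_X]
      refine Finset.prod_congr rfl fun k _ => ?_
      rw [← mul_pow]
      congr 1
      rw [← Finset.add_sum_erase _ _ (Finset.mem_univ (0 : Fin (n+1))), hU0, mul_add,
        Finset.mul_sum, one_mul, mul_one]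
      congr 1
      refine Finset.sum_congr rfl fun l _ => ?_
      field_simp
    rw [e1, ← h, Finset.mul_sum, map_sum]
    refine Finset.sum_congr rfl fun ζ hζ => ?_
    rw [mem_Omega] at hζ
    rw [eval_monomial, Finsupp.prod_fintype _ _ (by simp)]
    simp only [Finsupp.equivFunOnFinite_symm_apply_apply]
    have : z 0 ^ m * ∏ l ∈ Finset.univ.erase (0 : Fin (n + 1)), (z l / z 0) ^ ζ l =
        ∏ i, z i ^ ζ i := by
      rw [← hζ, ← Finset.prod_pow_eq_pow_sum,
        ← Finset.mul_prod_erase _ _ (Finset.mem_univ (0 : Fin (n+1))),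
        ← Finset.mul_prod_erase _ (fun i => z i ^ ζ i) (Finset.mem_univ (0 : Fin (n+1))),
        mul_assoc, ← Finset.prod_mul_distrib]
      congr 1
      refine Finset.prod_congr rfl fun l _ => ?_
      rw [← mul_pow]
      congr 1
      field_simp
    rw [← this]; ring
  rw [key, coeff_sum]
  simp only [coeff_monomial, EmbeddingLike.apply_eq_iff_eq]
  rw [Finset.sum_ite_eq', if_pos hξ]

open MvPolynomial in
lemma site_duality {n m : ℕ} (U W : Matrix (Fin (n + 1)) (Fin (n + 1)) ℝ) (hWU : W * U = 1)
    (K : (Fin (n + 1) → ℕ) → (Fin (n + 1) → ℕ) → ℝ)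
    (hc : ∀ η ∈ Omega n m, ∀ ξ ∈ Omega n m,
      coeff (Finsupp.equivFunOnFinite.symm ξ) (genF U η) =
      ((Nat.factorial m : ℝ) / ∏ i, (Nat.factorial (ξ i) : ℝ)) * K ξ η)
    (ξ η : Fin (n + 1) → ℕ) (hξ : ξ ∈ Omega n m) (hη : η ∈ Omega n m) (k l : Fin (n + 1)) :
    (ξ l : ℝ) * K (conf ξ k l) η =
      ∑ a, ∑ b, U a k * W l b * ((η a : ℝ) * K ξ (conf η b a)) := by
  classical
  have hne : (Nat.factorial m : ℝ) / ∏ i, (Nat.factorial (ξ i) : ℝ) ≠ 0 := by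
    refine div_ne_zero (by positivity) (Finset.prod_ne_zero_iff.mpr fun i _ => by positivity)
  have h := congrArg (coeff (Finsupp.equivFunOnFinite.symm ξ)) (X_mul_pderiv U W hWU k l η)
  have hR : coeff (Finsupp.equivFunOnFinite.symm ξ)
      (∑ a, ∑ b, C (U a k * W l b * η a) * genF U (conf η b a)) =
      (Nat.factorial m : ℝ) / (∏ i, (Nat.factorial (ξ i) : ℝ)) *
       ∑ a, ∑ b, U a k * W l b * ((η a : ℝ) * K ξ (conf η b a)) := by
    simp only [coeff_sum, coeff_C_mul, Finset.mul_sum]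
    refine Finset.sum_congr rfl fun a _ => Finset.sum_congr rfl fun b _ => ?_
    by_cases ha : η a = 0
    · simp [ha]
    rw [hc _ (conf_mem hη b a ha) _ hξ]; ring
  have hL : coeff (Finsupp.equivFunOnFinite.symm ξ) (X l * pderiv k (genF U η)) =
      (Nat.factorial m : ℝ) / (∏ i, (Nat.factorial (ξ i) : ℝ)) *
        ((ξ l : ℝ) * K (conf ξ k l) η) := by
    by_cases hl : ξ l = 0
    · rw [coeff_X_mul', if_neg (by simp [hl])]; simp [hl]
    have e1 : Finsupp.equivFunOnFinite.symm ξ =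
        Finsupp.single l 1 + Finsupp.equivFunOnFinite.symm (dec ξ l) := by
      ext i
      have := congrFun (dec_eq ξ l hl) i
      simp [Finsupp.single_apply, eq_comm (a := l)]
      omega
    have e2 : Finsupp.equivFunOnFinite.symm (dec ξ l) + Finsupp.single k 1 =
        Finsupp.equivFunOnFinite.symm (conf ξ k l) := by
      rw [conf_eq ξ k l hl]
      ext i
      simp [Finsupp.single_apply, eq_comm (a := k)]
    rw [e1, coeff_X_mul, coeff_pderiv, e2, hc _ hη _ (conf_mem hξ k l hl)]
    have f1 : ∏ i, (Nat.factorial (ξ i) : ℝ) =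
      (dec ξ l l + 1) * ∏ i, (Nat.factorial (dec ξ l i) : ℝ) := by
      rw [← prod_fact_add]
      exact congrArg (fun g : Fin (n+1) → ℕ => ∏ i, (Nat.factorial (g i) : ℝ)) (dec_eq ξ l hl)
    have f2 : ∏ i, (Nat.factorial (conf ξ k l i) : ℝ) =
      (dec ξ l k + 1) * ∏ i, (Nat.factorial (dec ξ l i) : ℝ) := by
      rw [← prod_fact_add, conf_eq ξ k l hl]
    have f3 : (ξ l : ℝ) = dec ξ l l + 1 := by
      have := congrFun (dec_eq ξ l hl) l
      simp only [if_true] at this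
      exact_mod_cast this
    have f4 : (∏ i, (Nat.factorial (dec ξ l i) : ℝ)) ≠ 0 :=
      Finset.prod_ne_zero_iff.mpr fun i _ => by positivity
    have f5 : (dec ξ l l + 1 : ℝ) ≠ 0 := by positivity
    have f6 : (dec ξ l k + 1 : ℝ) ≠ 0 := by positivity
    simp only [Finsupp.equivFunOnFinite_symm_apply_apply]
    rw [f1, f2, f3]
    field_simp
  rw [hL, hR] at h
  exact mul_left_cancel₀ hne h

lemma sepEdge_eq {V : Type*} [DecidableEq V] (n m : ℕ) (x y : V) (hxy : x ≠ y)
    (f : (V → Fin (n + 1) → ℕ) → ℝ) (ζ : V → Fin (n + 1) → ℕ)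
    (hζ : ∀ x, ζ x ∈ Omega n m) :
    sepEdge n x y f ζ =
      (∑ k, ∑ l, (ζ x l * ζ y k : ℝ) * f (sepMove ζ x y k l)) - (m : ℝ) * m * f ζ := by
  have hs : ∀ x, ∑ l, (ζ x l : ℝ) = m := fun x => by
    exact_mod_cast mem_Omega.mp (hζ x)
  have hswap : ∀ k l, sepMove ζ y x k l = sepMove ζ x y l k := by
    intro k l
    funext v
    unfold sepMove
    by_cases h1 : v = x
    · subst h1; simp [hxy]
    · simp [h1]
  have hdiag : ∀ k, sepMove ζ x y k k = ζ := by
    intro k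
    funext v
    unfold sepMove
    simp only [conf_self]
    by_cases h1 : v = x
    · simp [h1]
    · rw [if_neg h1]
      split_ifs with h2
      · rw [h2]
      · rfl
  let g : Fin (n+1) → Fin (n+1) → ℝ := fun k l =>
    (ζ x l * ζ y k : ℝ) * (f (sepMove ζ x y k l) - f ζ)
  have h1 : sepEdge n x y f ζ = ∑ k, ∑ l, g k l := by
    have : ∀ k l, g k l = (if k < l then g k l else 0) + (if l < k then g k l else 0) := by
      intro k l
      rcases lt_trichotomy k l with h | h | h
      · simp [h, h.not_gt]
      · subst h; simp [g, hdiag]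
      · simp [h, h.not_gt]
    rw [Finset.sum_congr rfl fun k _ => Finset.sum_congr rfl fun l _ => this k l]
    simp only [Finset.sum_add_distrib]
    rw [Finset.sum_comm (f := fun k l => if l < k then g k l else 0)]
    simp only [← Finset.sum_add_distrib]
    unfold sepEdge
    refine Finset.sum_congr rfl fun k _ => Finset.sum_congr rfl fun l _ => ?_
    by_cases h : k < l
    · simp only [h, if_true, g, hswap]; ring
    · simp [h]
  rw [h1]
  have h2 : (m : ℝ) * m * f ζ = ∑ k, ∑ l, (ζ x l * ζ y k : ℝ) * f ζ := by
    simp only [← Finset.sum_mul]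
    congr 1
    rw [← hs x]
    simp only [← Finset.sum_mul, ← Finset.mul_sum]
    rw [hs x, hs y]
  rw [h2]
  simp only [g, mul_sub, Finset.sum_sub_distrib]

lemma prod_two {V : Type*} [Fintype V] [DecidableEq V] (x y : V) (hxy : x ≠ y) (g : V → ℝ) :
    ∏ v, g v = g x * g y * ∏ v ∈ (Finset.univ.erase x).erase y, g v := by
  rw [← Finset.mul_prod_erase _ g (Finset.mem_univ x),
    ← Finset.mul_prod_erase _ g (Finset.mem_erase.mpr ⟨hxy.symm, Finset.mem_univ y⟩), mul_assoc]

lemma prod_move {V : Type*} [Fintype V] [DecidableEq V] {n : ℕ} (x y : V) (hxy : x ≠ y)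
    (H : V → (Fin (n+1) → ℕ) → ℝ) (ζ : V → Fin (n + 1) → ℕ) (k l : Fin (n+1)) :
    ∏ v, H v (sepMove ζ x y k l v) = H x (conf (ζ x) k l) * H y (conf (ζ y) l k) *
      ∏ v ∈ (Finset.univ.erase x).erase y, H v (ζ v) := by
  rw [prod_two x y hxy]
  have h1 : sepMove ζ x y k l x = conf (ζ x) k l := by simp [sepMove]
  have h2 : sepMove ζ x y k l y = conf (ζ y) l k := by simp [sepMove, hxy.symm]
  rw [h1, h2]
  congr 1
  refine Finset.prod_congr rfl fun v hv => ?_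
  simp only [Finset.mem_erase] at hv
  simp [sepMove, hv.1, hv.2.1]

/-- Self-duality of the multi-species SEP(2j) with respect to products of multivariate
Krawtchouk polynomials: `[L D(·,η)](ξ) = [L D(ξ,·)](η)` where
`D(ξ,η) = ∏_{x∈V} K(ξ^x,η^x)`. -/
theorem sep_self_duality_krawtchouk {V : Type*} [Fintype V] [DecidableEq V]
    (n m : ℕ) (hn : 1 ≤ n) (hm : 0 < m)
    (E : Finset (V × V)) (hE : ∀ e ∈ E, e.1 ≠ e.2)
    (ν : ℝ) (hν : ν ≠ 0) (p phat : Fin (n + 1) → ℝ)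
    (U : Matrix (Fin (n + 1)) (Fin (n + 1)) ℝ)
    (hp0 : p 0 = 1 / ν) (hphat0 : phat 0 = 1 / ν)
    (hU0 : ∀ k, U k 0 = 1 ∧ U 0 k = 1)
    (hmain : ν • (Matrix.diagonal p * U * Matrix.diagonal phat * U.transpose) = 1)
    (hp : ∀ i, 0 < p i) (hp1 : ∑ i, p i = 1)
    (hphat : ∀ i, 0 < phat i) (hphat1 : ∑ i, phat i = 1)
    (K : (Fin (n + 1) → ℕ) → (Fin (n + 1) → ℕ) → ℝ)
    (hK : ∀ η ∈ Omega n m, ∀ z : Fin (n + 1) → ℝ,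
      ∑ ξ ∈ Omega n m,
          ((Nat.factorial m : ℝ) / ∏ i, (Nat.factorial (ξ i) : ℝ)) * K ξ η *
            ∏ l ∈ Finset.univ.erase (0 : Fin (n + 1)), z l ^ ξ l =
        ∏ k : Fin (n + 1),
          (1 + ∑ l ∈ Finset.univ.erase (0 : Fin (n + 1)), U k l * z l) ^ η k) :
    ∀ ξ η : V → Fin (n + 1) → ℕ,
      (∀ x, ξ x ∈ Omega n m) → (∀ x, η x ∈ Omega n m) →
      sepGen n E (fun ξ' => ∏ x, K (ξ' x) (η x)) ξ =
        sepGen n E (fun η' => ∏ x, K (ξ x) (η' x)) η := by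
  intro ξ η hξ hη
  have hdet : IsUnit U := by
    have h : (Matrix.diagonal p * U * Matrix.diagonal phat) * (ν • U.transpose) = 1 := by
      rw [Matrix.mul_smul]; exact hmain
    have h' := mul_eq_one_comm.mp h
    have h2 : U.transpose * (ν • (Matrix.diagonal p * U * Matrix.diagonal phat)) = 1 := by
      rw [Matrix.mul_smul, ← Matrix.smul_mul]; exact h'
    have h3 := congrArg Matrix.transpose h2
    rw [Matrix.transpose_mul, Matrix.transpose_transpose, Matrix.transpose_one] at h3
    exact IsUnit.of_mul_eq_one_right _ h3
  obtain ⟨W, hUW, hWU⟩ : ∃ W, U * W = 1 ∧ W * U = 1 := by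
    obtain ⟨u, rfl⟩ := hdet
    exact ⟨_, u.mul_inv, u.inv_mul⟩
  have hsite := site_duality (m := m) U W hWU K (fun η hη ξ hξ =>
    coeff_genF U (fun k => (hU0 k).1) K η hη (hK η hη) ξ hξ)
  unfold sepGen
  refine Finset.sum_congr rfl fun e he => ?_
  obtain ⟨x, y⟩ := e
  have hxy : x ≠ y := hE _ he
  rw [sepEdge_eq n m x y hxy _ ξ hξ, sepEdge_eq n m x y hxy _ η hη]
  congr 1
  have hl := fun k l => prod_move x y hxy (fun v z => K z (η v)) ξ k l
  have hr := fun k l => prod_move x y hxy (fun v z => K (ξ v) z) η k l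
  simp only [hl, hr]
  set R := ∏ v ∈ (Finset.univ.erase x).erase y, K (ξ v) (η v)
  let M : V → Matrix (Fin (n+1)) (Fin (n+1)) ℝ := fun v =>
    Matrix.of fun k l => (ξ v l : ℝ) * K (conf (ξ v) k l) (η v)
  let N : V → Matrix (Fin (n+1)) (Fin (n+1)) ℝ := fun v =>
    Matrix.of fun a b => (η v a : ℝ) * K (ξ v) (conf (η v) b a)
  have hMN : ∀ v, M v = U.transpose * N v * W.transpose := by
    intro v
    ext k l
    simp only [M, N, Matrix.of_apply, Matrix.mul_apply, Matrix.transpose_apply, Finset.sum_mul]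
    rw [hsite _ _ (hξ v) (hη v) k l, Finset.sum_comm]
    refine Finset.sum_congr rfl fun b _ => Finset.sum_congr rfl fun a _ => ?_
    ring
  have hWUt : W.transpose * U.transpose = 1 := by
    rw [← Matrix.transpose_mul, hUW, Matrix.transpose_one]
  have htr : (M x * M y).trace = (N x * N y).trace := by
    rw [hMN, hMN]
    calc _ = (U.transpose * (N x * (W.transpose * U.transpose) * N y * W.transpose)).trace := by
            simp only [Matrix.mul_assoc]
      _ = (N x * N y * (W.transpose * U.transpose)).trace := by
            rw [Matrix.trace_mul_comm, hWUt]; simp only [Matrix.mul_assoc, hWUt, Matrix.mul_one, Matrix.one_mul]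
      _ = _ := by rw [hWUt, Matrix.mul_one]
  have t1 : ∑ k, ∑ l, (ξ x l * ξ y k : ℝ) *
      (K (conf (ξ x) k l) (η x) * K (conf (ξ y) l k) (η y) * R) = (M x * M y).trace * R := by
    simp only [Matrix.trace, Matrix.diag, Matrix.mul_apply, M, Matrix.of_apply, Finset.sum_mul]
    refine Finset.sum_congr rfl fun b _ => Finset.sum_congr rfl fun a _ => ?_
    ring
  have t2 : ∑ k, ∑ l, (η x l * η y k : ℝ) *
      (K (ξ x) (conf (η x) k l) * K (ξ y) (conf (η y) l k) * R) = (N x * N y).trace * R := by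
    simp only [Matrix.trace, Matrix.diag, Matrix.mul_apply, N, Matrix.of_apply, Finset.sum_mul]
    rw [Finset.sum_comm]
    refine Finset.sum_congr rfl fun b _ => Finset.sum_congr rfl fun a _ => ?_
    ring
  rw [t1, t2, htr]
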